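/- Let k be an infinite field and c⃗ = (c₁,…,c_m). For λ ∈ (kˣ)^m let φ_λ be the k-algebra automorphism of A⁺_{c⃗} determined by tᵢ ↦ λᵢtᵢ. If B ⊆ A⁺_{c⃗} is a k-subalgebra with φ_λ(B) = B for every λ ∈ (kˣ)^m, then B is spanned as a k-vector space by 1 together with the monomials it contains: B = k·1 ⊕ span_k{tᵢ^d : 1 ≤ d ≤ cᵢ − 1, tᵢ^d ∈ B}. Consequently, by the correspondence between monomial subalgebras and tuples of numerical monoids, the (kˣ)^m-invariant corank-g subalgebras of A⁺_{c⃗} are in bijection with tuples (M₁,…,M_m) of numerical monoids with c(Mᵢ) ≤ cᵢ for each i and Σᵢ g(Mᵢ) = g. -/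

import Mathlib

set_option synthInstance.maxHeartbeats 1000000
set_option maxHeartbeats 2000000
open Polynomial

/-- The truncated polynomial ring `k[X]/(X^c)`. -/
abbrev TruncP (k : Type*) [CommRing k] (c : ℕ) : Type _ :=
  Polynomial k ⧸ Ideal.span {(X : Polynomial k) ^ c}

/-- The ambient product algebra `∏ i, k[tᵢ]/(tᵢ^{cᵢ})`. -/
abbrev TruncPi (k : Type*) [CommRing k] {ι : Type*} (c : ι → ℕ) : Type _ :=
  ∀ i, TruncP k (c i)

/-- The image of `X` in `TruncP k c`. -/
noncomputable def truncX (k : Type*) [CommRing k] (c : ℕ) : TruncP k c :=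
  Ideal.Quotient.mk _ X

/-- The monomial `tᵢ^j` in `∏ i, k[tᵢ]/(tᵢ^{cᵢ})`. -/
noncomputable def tpow {k : Type*} [CommRing k] {ι : Type*} [DecidableEq ι]
    (c : ι → ℕ) (i : ι) (j : ℕ) : TruncPi k c :=
  Pi.single i (truncX k (c i) ^ j)

/-- The constant term of a truncated polynomial (evaluation at `0`), for `c ≥ 1`. -/
noncomputable def constTerm (k : Type*) [CommRing k] (c : ℕ) (hc : 1 ≤ c) :
    TruncP k c →ₐ[k] k :=
  Ideal.Quotient.liftₐ _ (aeval (0 : k)) (by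
    intro a ha
    rw [Ideal.mem_span_singleton] at ha
    obtain ⟨q, rfl⟩ := ha
    have h0 : (0 : k) ^ c = 0 := zero_pow (Nat.one_le_iff_ne_zero.mp hc)
    simp [h0])

/-- `A⁺`: the subalgebra of tuples with all constant terms equal. -/
noncomputable def Aplus (k : Type*) [CommRing k] {ι : Type*} (c : ι → ℕ)
    (hc : ∀ i, 1 ≤ c i) : Subalgebra k (TruncPi k c) :=
  ⨅ (i : ι) (j : ι),
    AlgHom.equalizer
      ((constTerm k (c i) (hc i)).comp (Pi.evalAlgHom k (fun i => TruncP k (c i)) i))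
      ((constTerm k (c j) (hc j)).comp (Pi.evalAlgHom k (fun i => TruncP k (c i)) j))

/-- `m_I`: the span of the monomials `tᵢ^j`, `i ∈ I`, `1 ≤ j ≤ cᵢ - 1`. -/
noncomputable def mPart (k : Type*) [CommRing k] {ι : Type*} [DecidableEq ι]
    (c : ι → ℕ) (I : Set ι) : Submodule k (TruncPi k c) :=
  Submodule.span k {x | ∃ i ∈ I, ∃ j, 1 ≤ j ∧ j < c i ∧ x = tpow c i j}

/-- `𝔪^d`: the span of the monomials of degree at least `d`. -/
noncomputable def mPow (k : Type*) [CommRing k] {ι : Type*} [DecidableEq ι]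
    (c : ι → ℕ) (d : ℕ) : Submodule k (TruncPi k c) :=
  Submodule.span k {x | ∃ i, ∃ j, d ≤ j ∧ 1 ≤ j ∧ j < c i ∧ x = tpow c i j}

/-- Componentwise projection onto the coordinates in `I` (the projection along `m_{Iᶜ}`). -/
noncomputable def projL (k : Type*) [CommRing k] {ι : Type*} [DecidableEq ι] (c : ι → ℕ)
    (I : Finset ι) : TruncPi k c →ₗ[k] TruncPi k c where
  toFun x i := if i ∈ I then x i else 0
  map_add' x y := by funext i; by_cases h : i ∈ I <;> simp [h]
  map_smul' r x := by funext i; by_cases h : i ∈ I <;> simp [h]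

/-- Scaling `t ↦ λ·t` on `k[t]/(t^c)`, as a `k`-algebra homomorphism. -/
noncomputable def scaleHom (k : Type*) [CommRing k] (c : ℕ) (lam : k) :
    TruncP k c →ₐ[k] TruncP k c :=
  Ideal.Quotient.liftₐ _ (aeval (lam • truncX k c)) (by
    intro a ha
    rw [Ideal.mem_span_singleton] at ha
    obtain ⟨q, rfl⟩ := ha
    have hx : truncX k c ^ c = 0 := by
      show (Ideal.Quotient.mk (Ideal.span {(X : Polynomial k) ^ c}) X) ^ c = 0
      rw [← map_pow, Ideal.Quotient.eq_zero_iff_mem]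
      exact Ideal.mem_span_singleton_self _
    simp [_root_.smul_pow, hx])

/-- The torus action `tᵢ ↦ λᵢ·tᵢ` on `∏ i, k[tᵢ]/(tᵢ^{cᵢ})`. -/
noncomputable def torusHom {k : Type*} [CommRing k] {ι : Type*} (c : ι → ℕ) (lam : ι → k) :
    TruncPi k c →ₐ[k] TruncPi k c :=
  Pi.algHom k _ fun i => (scaleHom k (c i) (lam i)).comp (Pi.evalAlgHom k _ i)

/-- Restriction of a tuple to the coordinates satisfying `P`, as an algebra hom. -/
noncomputable def restrictAlg (k : Type*) [CommRing k] {ι : Type*} (c : ι → ℕ)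
    (P : ι → Prop) : TruncPi k c →ₐ[k] TruncPi k (fun i : {i // P i} => c i.1) where
  toFun x i := x i.1
  map_one' := rfl
  map_mul' _ _ := rfl
  map_zero' := rfl
  map_add' _ _ := rfl
  commutes' _ := rfl

/-- The set `k·1 ⊕ {b + b' + φ(b')}` associated to a gluing datum. -/
def graphSet {k A : Type*} [CommRing k] [CommRing A] [Algebra k A]
    (bI bI' : Submodule k A) (φ : ↥bI' →ₗ[k] A) : Set A :=
  {z | ∃ r : k, ∃ b ∈ bI, ∃ b' : ↥bI', z = r • (1 : A) + b + ↑b' + φ b'}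

section CoefficientFunctionals

variable {k : Type*} [CommRing k]

/-- The coefficient of `t^d` in `k[t]/(t^c)`, which is `0` for `d ≥ c`. -/
noncomputable def truncCoeff (k : Type*) [CommRing k] (c d : ℕ) : TruncP k c →ₗ[k] k :=
  (((Ideal.span {(X : Polynomial k) ^ c}).restrictScalars k).liftQ
    (if d < c then lcoeff k d else 0) (by
      intro p hp
      obtain ⟨q, rfl⟩ := Ideal.mem_span_singleton.mp hp
      split_ifs with h
      · simp [coeff_X_pow_mul', h]
      · simp)) ∘ₗ
    (Submodule.Quotient.restrictScalarsEquiv k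
      (Ideal.span {(X : Polynomial k) ^ c})).symm.toLinearMap

theorem truncCoeff_mk (c d : ℕ) (p : Polynomial k) :
    truncCoeff k c d (Ideal.Quotient.mk _ p) = if d < c then p.coeff d else 0 := by
  have h : truncCoeff k c d (Ideal.Quotient.mk _ p) =
      (if d < c then lcoeff k d else 0 : Polynomial k →ₗ[k] k) p := rfl
  rw [h]
  split_ifs <;> simp

theorem truncX_pow_eq_zero {c d : ℕ} (h : c ≤ d) : truncX k c ^ d = 0 := by
  rw [truncX, ← map_pow, Ideal.Quotient.eq_zero_iff_mem]
  exact Ideal.mem_span_singleton.mpr (pow_dvd_pow _ h)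

theorem truncCoeff_truncX_pow (c d e : ℕ) :
    truncCoeff k c d (truncX k c ^ e) = if d < c ∧ d = e then 1 else 0 := by
  rw [truncX, ← map_pow, truncCoeff_mk, coeff_X_pow, ite_and]

theorem truncCoeff_one (c d : ℕ) :
    truncCoeff k c d 1 = if d < c ∧ d = 0 then 1 else 0 := by
  simpa using truncCoeff_truncX_pow (k := k) c d 0

theorem truncP_induction {c : ℕ} {C : TruncP k c → Prop} (x : TruncP k c)
    (add : ∀ x y, C x → C y → C (x + y))
    (smul_pow : ∀ (a : k) (d : ℕ), C (a • truncX k c ^ d)) : C x := by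
  obtain ⟨p, rfl⟩ := Ideal.Quotient.mk_surjective x
  induction p using Polynomial.induction_on' with
  | add p q hp hq => rw [map_add]; exact add _ _ hp hq
  | monomial d a =>
    have h : Ideal.Quotient.mk (Ideal.span {(X : Polynomial k) ^ c}) (monomial d a) =
        a • truncX k c ^ d := by
      rw [truncX, ← map_pow, ← smul_X_eq_monomial]
      rfl
    rw [h]
    exact smul_pow a d

theorem sum_truncCoeff_smul (c : ℕ) (x : TruncP k c) :
    ∑ d ∈ Finset.range c, truncCoeff k c d x • truncX k c ^ d = x := by
  induction x using truncP_induction with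
  | add x y hx hy => simp only [map_add, add_smul, Finset.sum_add_distrib, hx, hy]
  | smul_pow a e =>
    by_cases he : e < c
    · rw [Finset.sum_eq_single e]
      · simp [truncCoeff_truncX_pow, he]
      · intro d _ hde
        simp [truncCoeff_truncX_pow, hde]
      · simp [he]
    · simp [truncX_pow_eq_zero (not_lt.mp he)]

theorem truncP_ext {c : ℕ} {x y : TruncP k c}
    (h : ∀ d < c, truncCoeff k c d x = truncCoeff k c d y) : x = y := by
  rw [← sum_truncCoeff_smul c x, ← sum_truncCoeff_smul c y]
  exact Finset.sum_congr rfl fun d hd => by rw [h d (Finset.mem_range.mp hd)]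

theorem scaleHom_truncX (c : ℕ) (lam : k) :
    scaleHom k c lam (truncX k c) = lam • truncX k c := by
  have h : scaleHom k c lam (truncX k c) = aeval (lam • truncX k c) (X : Polynomial k) := rfl
  rw [h, aeval_X]

theorem truncCoeff_scaleHom (c d : ℕ) (lam : k) (x : TruncP k c) :
    truncCoeff k c d (scaleHom k c lam x) = lam ^ d * truncCoeff k c d x := by
  induction x using truncP_induction with
  | add x y hx hy => simp only [map_add, mul_add, hx, hy]
  | smul_pow a e =>
    simp only [map_smul, map_pow, scaleHom_truncX, _root_.smul_pow, truncCoeff_truncX_pow,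
      smul_eq_mul]
    split_ifs with h
    · rw [h.2]; ring
    · simp

theorem constTerm_eq_truncCoeff (c : ℕ) (hc : 1 ≤ c) (x : TruncP k c) :
    constTerm k c hc x = truncCoeff k c 0 x := by
  obtain ⟨p, rfl⟩ := Ideal.Quotient.mk_surjective x
  have h : constTerm k c hc (Ideal.Quotient.mk _ p) = aeval (0 : k) p := rfl
  rw [h, truncCoeff_mk, if_pos (Nat.lt_of_lt_of_le Nat.zero_lt_one hc), coeff_zero_eq_aeval_zero]

end CoefficientFunctionals

section MonomialSpans

variable {k : Type*} [CommRing k] {ι : Type*}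

theorem truncPi_ext {c : ι → ℕ} {x y : TruncPi k c}
    (h : ∀ i, ∀ d < c i, truncCoeff k (c i) d (x i) = truncCoeff k (c i) d (y i)) : x = y :=
  funext fun i => truncP_ext (h i)

theorem truncCoeff_torusHom (c : ι → ℕ) (lam : ι → k) (x : TruncPi k c) (i : ι) (d : ℕ) :
    truncCoeff k (c i) d (torusHom c lam x i) = lam i ^ d * truncCoeff k (c i) d (x i) :=
  truncCoeff_scaleHom _ _ _ _

theorem mem_Aplus_iff (c : ι → ℕ) (hc : ∀ i, 1 ≤ c i) (x : TruncPi k c) :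
    x ∈ Aplus k c hc ↔
      ∀ i j, truncCoeff k (c i) 0 (x i) = truncCoeff k (c j) 0 (x j) := by
  simp only [Aplus, Algebra.mem_iInf, AlgHom.mem_equalizer, AlgHom.comp_apply,
    Pi.evalAlgHom_apply, constTerm_eq_truncCoeff]

variable [DecidableEq ι]

theorem truncCoeff_tpow (c : ι → ℕ) (i j : ι) (d e : ℕ) :
    truncCoeff k (c i) d (tpow (k := k) c j e i) =
      if d < c i ∧ i = j ∧ d = e then 1 else 0 := by
  by_cases h : i = j
  · subst h
    simp [tpow, truncCoeff_truncX_pow]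
  · simp [tpow, h]

theorem tpow_eq_zero (c : ι → ℕ) (i : ι) {d : ℕ} (h : c i ≤ d) :
    tpow (k := k) c i d = 0 := by
  rw [tpow, truncX_pow_eq_zero h, Pi.single_zero]

theorem tpow_mul_tpow_self (c : ι → ℕ) (i : ι) (d e : ℕ) :
    tpow (k := k) c i d * tpow c i e = tpow c i (d + e) := by
  rw [tpow, tpow, tpow, ← Pi.single_mul, pow_add]

theorem tpow_mul_tpow_of_ne (c : ι → ℕ) {i j : ι} (h : i ≠ j) (d e : ℕ) :
    tpow (k := k) c i d * tpow c j e = 0 := by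
  funext l
  by_cases hl : l = i
  · subst hl
    simp [tpow, h]
  · simp [tpow, hl]

/-- The span of `1` and the monomials `tᵢ^d`, `1 ≤ d < cᵢ`, whose exponent satisfies `P i`. -/
noncomputable def monomialSpan (k : Type*) [CommRing k] (c : ι → ℕ) (P : ι → ℕ → Prop) :
    Submodule k (TruncPi k c) :=
  Submodule.span k ({1} ∪ {x | ∃ i, ∃ d, 1 ≤ d ∧ d < c i ∧ P i d ∧ x = tpow c i d})

theorem one_mem_monomialSpan (c : ι → ℕ) (P : ι → ℕ → Prop) :
    (1 : TruncPi k c) ∈ monomialSpan k c P :=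
  Submodule.subset_span (Or.inl rfl)

theorem tpow_mem_monomialSpan (c : ι → ℕ) {P : ι → ℕ → Prop} {i : ι} {d : ℕ} (h1 : 1 ≤ d)
    (hP : d < c i → P i d) : tpow c i d ∈ monomialSpan k c P := by
  by_cases h : d < c i
  · exact Submodule.subset_span (Or.inr ⟨i, d, h1, h, hP h, rfl⟩)
  · rw [tpow_eq_zero c i (not_lt.mp h)]
    exact zero_mem _

theorem truncPi_eq_sum [Fintype ι] (c : ι → ℕ) (x : TruncPi k c) (a : k)
    (ha : ∀ i, truncCoeff k (c i) 0 (x i) = a) :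
    x = a • 1 + ∑ i, ∑ d ∈ Finset.Ico 1 (c i), truncCoeff k (c i) d (x i) • tpow c i d := by
  refine truncPi_ext fun i d hd => ?_
  simp only [Pi.add_apply, Pi.smul_apply, Pi.one_apply, Finset.sum_apply, map_add, map_sum,
    map_smul, truncCoeff_tpow, truncCoeff_one, smul_eq_mul]
  rw [Finset.sum_eq_single i (fun j _ hj => Finset.sum_eq_zero fun e _ => by simp [hj.symm])
    (by simp)]
  rcases Nat.eq_zero_or_pos d with rfl | h0
  · rw [Finset.sum_eq_zero]
    · simp [ha, hd]
    · intro e he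
      have := (Finset.mem_Ico.mp he).1
      rw [if_neg (by omega), mul_zero]
  · rw [Finset.sum_eq_single d]
    · simp [hd, h0.ne']
    · intro e _ he
      simp [he.symm]
    · intro h
      exact absurd (Finset.mem_Ico.mpr ⟨h0, hd⟩) h

theorem mem_monomialSpan_iff [Fintype ι] [Nonempty ι] (c : ι → ℕ) (hc : ∀ i, 1 ≤ c i)
    (P : ι → ℕ → Prop) (x : TruncPi k c) :
    x ∈ monomialSpan k c P ↔
      x ∈ Aplus k c hc ∧
        ∀ i d, 1 ≤ d → d < c i → ¬ P i d → truncCoeff k (c i) d (x i) = 0 := by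
  rw [mem_Aplus_iff]
  constructor
  · intro hx
    induction hx using Submodule.span_induction with
    | mem x hx =>
      rcases hx with rfl | ⟨j, e, h1, -, hP, rfl⟩
      · refine ⟨fun i j => ?_, fun i d h1 _ _ => ?_⟩
        · simp [truncCoeff_one, Nat.lt_of_lt_of_le Nat.zero_lt_one (hc _)]
        · rw [Pi.one_apply, truncCoeff_one, if_neg (by omega)]
      · refine ⟨fun i j => ?_, fun i d _ _ hd => ?_⟩
        · rw [truncCoeff_tpow, truncCoeff_tpow, if_neg (by omega), if_neg (by omega)]
        · rw [truncCoeff_tpow, if_neg]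
          rintro ⟨-, rfl, rfl⟩
          exact hd hP
    | zero => simp
    | add x y _ _ hx hy =>
      refine ⟨fun i j => ?_, fun i d h1 h2 hP => ?_⟩
      · simp only [Pi.add_apply, map_add, hx.1 i j, hy.1 i j]
      · simp only [Pi.add_apply, map_add, hx.2 i d h1 h2 hP, hy.2 i d h1 h2 hP, add_zero]
    | smul a x _ hx =>
      refine ⟨fun i j => ?_, fun i d h1 h2 hP => ?_⟩
      · simp only [Pi.smul_apply, map_smul, hx.1 i j]
      · simp only [Pi.smul_apply, map_smul, hx.2 i d h1 h2 hP, smul_zero]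
  · rintro ⟨h0, hx⟩
    obtain ⟨i₀⟩ := ‹Nonempty ι›
    rw [truncPi_eq_sum c x _ fun i => h0 i i₀]
    refine add_mem (Submodule.smul_mem _ _ (one_mem_monomialSpan c P))
      (sum_mem fun i _ => sum_mem fun d hd => ?_)
    rw [Finset.mem_Ico] at hd
    by_cases hP : P i d
    · exact Submodule.smul_mem _ _ (tpow_mem_monomialSpan c hd.1 fun _ => hP)
    · rw [hx i d hd.1 hd.2 hP]
      exact (zero_smul k (tpow (k := k) c i d)).symm ▸ zero_mem _

theorem toSubmodule_Aplus [Fintype ι] [Nonempty ι] (c : ι → ℕ) (hc : ∀ i, 1 ≤ c i) :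
    Subalgebra.toSubmodule (Aplus k c hc) = monomialSpan k c fun _ _ => True := by
  ext x
  simp [mem_monomialSpan_iff c hc]

theorem tpow_mem_monomialSpan_iff [Fintype ι] [Nonempty ι] [Nontrivial k] (c : ι → ℕ)
    (hc : ∀ i, 1 ≤ c i) (P : ι → ℕ → Prop) {i : ι} {d : ℕ} (h1 : 1 ≤ d) (hd : d < c i) :
    tpow c i d ∈ monomialSpan k c P ↔ P i d := by
  refine ⟨fun h => ?_, fun h => tpow_mem_monomialSpan c h1 fun _ => h⟩
  by_contra hP
  simpa [truncCoeff_tpow, hd] using ((mem_monomialSpan_iff c hc P _).mp h).2 i d h1 hd hP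

theorem monomialSpan_mul_le (c : ι → ℕ) (M : ι → AddSubmonoid ℕ) :
    monomialSpan k c (fun i d => d ∈ M i) * monomialSpan k c (fun i d => d ∈ M i) ≤
      monomialSpan k c (fun i d => d ∈ M i) := by
  conv_lhs => rw [monomialSpan, Submodule.span_mul_span]
  rw [Submodule.span_le]
  rintro _ ⟨x, hx, y, hy, rfl⟩
  rcases hx with rfl | ⟨i, d, h1, -, hd, rfl⟩
  · change 1 * y ∈ monomialSpan k c _
    rw [one_mul]
    exact Submodule.subset_span hy
  rcases hy with rfl | ⟨j, e, -, -, he, rfl⟩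
  · change tpow c i d * 1 ∈ monomialSpan k c _
    rw [mul_one]
    exact tpow_mem_monomialSpan c h1 fun _ => hd
  change tpow c i d * tpow c j e ∈ monomialSpan k c _
  by_cases h : i = j
  · subst h
    rw [tpow_mul_tpow_self]
    exact tpow_mem_monomialSpan c (Nat.le_add_right_of_le h1) fun _ => (M i).add_mem hd he
  · rw [tpow_mul_tpow_of_ne c h]
    exact zero_mem _

/-- The monomial subalgebra attached to a tuple of submonoids of `ℕ`. -/
noncomputable def monomialSubalgebra (k : Type*) [CommRing k] (c : ι → ℕ)
    (M : ι → AddSubmonoid ℕ) : Subalgebra k (TruncPi k c) :=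
  (monomialSpan k c fun i d => d ∈ M i).toSubalgebra (one_mem_monomialSpan c _)
    fun _ _ hx hy => monomialSpan_mul_le c M (Submodule.mul_mem_mul hx hy)

theorem map_torusHom_eq_of_toSubmodule_eq [Fintype ι] [Nonempty ι] (c : ι → ℕ)
    (hc : ∀ i, 1 ≤ c i) (P : ι → ℕ → Prop) {B : Subalgebra k (TruncPi k c)}
    (hB : Subalgebra.toSubmodule B = monomialSpan k c P) (lam : ι → kˣ) :
    Subalgebra.map (torusHom c fun i => (lam i : k)) B = B := by
  have key : ∀ mu : ι → k, ∀ x ∈ B, torusHom c mu x ∈ B := by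
    intro mu x hx
    rw [← Subalgebra.mem_toSubmodule, hB, mem_monomialSpan_iff c hc, mem_Aplus_iff] at hx ⊢
    refine ⟨fun i j => ?_, fun i d h1 h2 hP => ?_⟩
    · rw [truncCoeff_torusHom, truncCoeff_torusHom, hx.1 i j, pow_zero, pow_zero]
    · rw [truncCoeff_torusHom, hx.2 i d h1 h2 hP, mul_zero]
  apply le_antisymm
  · rintro _ ⟨x, hx, rfl⟩
    exact key _ x hx
  · intro x hx
    refine ⟨torusHom c (fun i => (((lam i)⁻¹ : kˣ) : k)) x, key _ x hx, truncPi_ext fun i d _ => ?_⟩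
    simp only [RingHom.coe_coe]
    rw [truncCoeff_torusHom, truncCoeff_torusHom, ← mul_assoc, ← mul_pow, Units.mul_inv, one_pow,
      one_mul]

open Classical in
theorem finrank_monomialSpan [Fintype ι] [Nonempty ι] [Nontrivial k] (c : ι → ℕ)
    (hc : ∀ i, 1 ≤ c i) (P : ι → ℕ → Prop) :
    Module.finrank k (monomialSpan k c P) =
      ∑ i, ((Finset.Ico 1 (c i)).filter (P i)).card + 1 := by
  obtain ⟨i₀⟩ := ‹Nonempty ι›
  let T : Finset (Σ _ : ι, ℕ) := Finset.univ.sigma fun i => (Finset.Ico 1 (c i)).filter (P i)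
  have hT : ∀ p : T, (1 ≤ p.1.2 ∧ p.1.2 < c p.1.1) ∧ P p.1.1 p.1.2 := fun p => by
    simpa only [T, Finset.mem_sigma, Finset.mem_univ, true_and, Finset.mem_filter,
      Finset.mem_Ico] using p.2
  let v : Option T → TruncPi k c := fun o => o.elim 1 fun p => tpow c p.1.1 p.1.2
  let f : Option T → Module.Dual k (TruncPi k c) := fun o =>
    o.elim (truncCoeff k (c i₀) 0 ∘ₗ LinearMap.proj i₀)
      fun p => truncCoeff k (c p.1.1) p.1.2 ∘ₗ LinearMap.proj p.1.1
  have hv : LinearIndependent k v := by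
    refine LinearIndependent.of_pairwise_dual_eq_zero_one v f ?_ ?_
    · rintro (_ | p) (_ | q) hpq
      · exact absurd rfl hpq
      · have := (hT q).1.1
        simp only [f, v, Option.elim, LinearMap.comp_apply, LinearMap.proj_apply,
          truncCoeff_tpow]
        rw [if_neg (by omega)]
      · have := (hT p).1.1
        simp only [f, v, Option.elim, LinearMap.comp_apply, LinearMap.proj_apply,
          Pi.one_apply, truncCoeff_one]
        rw [if_neg (by omega)]
      · simp only [f, v, Option.elim, LinearMap.comp_apply, LinearMap.proj_apply,
          truncCoeff_tpow]
        rw [if_neg]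
        rintro ⟨-, h1, h2⟩
        exact hpq (congrArg some (Subtype.ext (Sigma.ext h1 (heq_of_eq h2))))
    · rintro (_ | p)
      · have := hc i₀
        simp only [f, v, Option.elim, LinearMap.comp_apply, LinearMap.proj_apply,
          Pi.one_apply, truncCoeff_one]
        rw [if_pos ⟨this, trivial⟩]
      · simp [f, v, truncCoeff_tpow, (hT p).1.2]
  have hspan : monomialSpan k c P = Submodule.span k (Set.range v) := by
    rw [monomialSpan]
    congr 1
    ext x
    constructor
    · rintro (rfl | ⟨i, d, h1, h2, hP, rfl⟩)
      · exact ⟨none, rfl⟩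
      · exact ⟨some ⟨⟨i, d⟩, by simp only [T, Finset.mem_sigma, Finset.mem_univ, Finset.mem_filter,
          Finset.mem_Ico, h1, h2, hP, and_self]⟩, rfl⟩
    · rintro ⟨_ | p, rfl⟩
      · exact Or.inl rfl
      · exact Or.inr ⟨p.1.1, p.1.2, (hT p).1.1, (hT p).1.2, (hT p).2, rfl⟩
  rw [hspan, finrank_span_eq_card hv, Fintype.card_option, Fintype.card_coe, Finset.card_sigma]

open Classical in
theorem card_filter_add_ncard_compl {c : ℕ} {M : AddSubmonoid ℕ} (hM : ∀ n, c ≤ n → n ∈ M) :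
    ((Finset.Ico 1 c).filter (· ∈ M)).card + {n : ℕ | n ∉ M}.ncard = (Finset.Ico 1 c).card := by
  have h : {n : ℕ | n ∉ M} = ((Finset.Ico 1 c).filter (· ∉ M) : Finset ℕ) := by
    ext n
    simp only [Set.mem_ofPred_eq, Finset.coe_filter, Finset.mem_Ico]
    refine ⟨fun hn => ⟨⟨?_, ?_⟩, hn⟩, And.right⟩
    · rw [Nat.one_le_iff_ne_zero]
      rintro rfl
      exact hn M.zero_mem
    · exact lt_of_not_ge fun h => hn (hM n h)
  rw [h, Set.ncard_coe_finset, Finset.card_filter_add_card_filter_not]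

theorem finrank_add_sum_ncard_compl [Fintype ι] [Nonempty ι] [Nontrivial k] (c : ι → ℕ)
    (hc : ∀ i, 1 ≤ c i) {M : ι → AddSubmonoid ℕ} (hM : ∀ i, ∀ n, c i ≤ n → n ∈ M i)
    {B : Subalgebra k (TruncPi k c)}
    (hB : Subalgebra.toSubmodule B = monomialSpan k c fun i d => d ∈ M i) :
    Module.finrank k B + ∑ i, {n : ℕ | n ∉ M i}.ncard = Module.finrank k (Aplus k c hc) := by
  classical
  rw [← Subalgebra.finrank_toSubmodule, ← Subalgebra.finrank_toSubmodule, hB,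
    toSubmodule_Aplus, finrank_monomialSpan c hc, finrank_monomialSpan c hc, add_right_comm,
    ← Finset.sum_add_distrib]
  congr 1
  refine Finset.sum_congr rfl fun i _ => ?_
  rw [Finset.filter_true, ← card_filter_add_ncard_compl (hM i)]

/-- The exponents of the powers of `tᵢ` lying in `B`, together with `0`. -/
def exponentMonoid {c : ι → ℕ} (B : Subalgebra k (TruncPi k c)) (i : ι) : AddSubmonoid ℕ where
  carrier := {n | n = 0 ∨ tpow c i n ∈ B}
  zero_mem' := Or.inl rfl
  add_mem' := by
    rintro a b (rfl | ha) (rfl | hb)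
    · exact Or.inl rfl
    · exact Or.inr (by rwa [zero_add])
    · exact Or.inr (by rwa [add_zero])
    · exact Or.inr (by rw [← tpow_mul_tpow_self]; exact mul_mem ha hb)

theorem mem_exponentMonoid_iff {c : ι → ℕ} (B : Subalgebra k (TruncPi k c)) {i : ι} {d : ℕ}
    (h1 : 1 ≤ d) : d ∈ exponentMonoid B i ↔ tpow c i d ∈ B :=
  or_iff_right (Nat.one_le_iff_ne_zero.mp h1)

theorem mem_exponentMonoid_of_le {c : ι → ℕ} (B : Subalgebra k (TruncPi k c)) {i : ι} {d : ℕ}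
    (h : c i ≤ d) : d ∈ exponentMonoid B i :=
  Or.inr (by rw [tpow_eq_zero c i h]; exact zero_mem B)

end MonomialSpans

section TorusInvariance

variable {k : Type*} [Field k] [Infinite k] {ι : Type*} [DecidableEq ι]

theorem tpow_mem_of_invariant (c : ι → ℕ) {B : Subalgebra k (TruncPi k c)}
    (hB : ∀ lam : ι → kˣ, Subalgebra.map (torusHom c fun i => (lam i : k)) B = B)
    {x : TruncPi k c} (hx : x ∈ B) {i : ι} {d : ℕ} (h1 : 1 ≤ d) (hd : d < c i)
    (hxd : truncCoeff k (c i) d (x i) ≠ 0) : tpow c i d ∈ B := by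
  by_contra hnot
  obtain ⟨f, hf, hBf⟩ := Submodule.exists_le_ker_of_notMem
    (p := Subalgebra.toSubmodule B) (v := tpow c i d) hnot
  let p : Polynomial k := C (f (x - Pi.single i (x i))) +
    ∑ e ∈ Finset.range (c i), C (truncCoeff k (c i) e (x i) * f (tpow c i e)) * X ^ e
  have hroot : ∀ u : kˣ, p.IsRoot u := by
    intro u
    let lam : ι → kˣ := Function.update 1 i u
    have hmem : torusHom c (fun j => (lam j : k)) x ∈ B := by
      rw [← hB lam]
      exact ⟨x, hx, rfl⟩
    have hexp : torusHom c (fun j => (lam j : k)) x = (x - Pi.single i (x i)) +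
        ∑ e ∈ Finset.range (c i), ((u : k) ^ e * truncCoeff k (c i) e (x i)) • tpow c i e := by
      refine truncPi_ext fun j e he => ?_
      rw [truncCoeff_torusHom]
      simp only [Pi.add_apply, Pi.sub_apply, Pi.smul_apply, Finset.sum_apply, map_add, map_sub,
        map_sum, map_smul, truncCoeff_tpow, smul_eq_mul]
      by_cases hj : j = i
      · subst hj
        rw [Finset.sum_eq_single e]
        · simp [lam, he]
        · intro e' _ h
          simp [h.symm]
        · simp [he]
      · simp [lam, hj]
    have h0 : f (torusHom c (fun j => (lam j : k)) x) = 0 := hBf hmem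
    rw [hexp, map_add, map_sum] at h0
    rw [IsRoot.def, ← h0]
    simp only [p, eval_add, eval_C, eval_finsetSum, eval_mul, eval_pow, eval_X, map_smul,
      smul_eq_mul]
    congr 1
    exact Finset.sum_congr rfl fun e _ => by ring
  have hp : p = 0 := by
    refine eq_zero_of_infinite_isRoot p ((Set.finite_singleton (0 : k)).infinite_compl.mono ?_)
    intro u hu
    exact hroot (Units.mk0 u hu)
  have hcoeff : p.coeff d = truncCoeff k (c i) d (x i) * f (tpow c i d) := by
    simp only [p, coeff_add, coeff_C, finsetSum_coeff, coeff_C_mul, coeff_X_pow]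
    simp [Nat.one_le_iff_ne_zero.mp h1, hd]
  rw [hp, coeff_zero] at hcoeff
  exact mul_ne_zero hxd hf hcoeff.symm

theorem toSubmodule_eq_monomialSpan_of_invariant [Fintype ι] [Nonempty ι] (c : ι → ℕ)
    (hc : ∀ i, 1 ≤ c i) {B : Subalgebra k (TruncPi k c)} (hBA : B ≤ Aplus k c hc)
    (hB : ∀ lam : ι → kˣ, Subalgebra.map (torusHom c fun i => (lam i : k)) B = B) :
    Subalgebra.toSubmodule B = monomialSpan k c fun i d => tpow c i d ∈ B := by
  apply le_antisymm
  · intro x hx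
    rw [mem_monomialSpan_iff c hc]
    refine ⟨hBA hx, fun i d h1 h2 hP => ?_⟩
    by_contra hne
    exact hP (tpow_mem_of_invariant c hB hx h1 h2 hne)
  · rw [monomialSpan, Submodule.span_le]
    rintro x (rfl | ⟨i, d, -, -, hP, rfl⟩)
    · exact one_mem B
    · exact hP

theorem toSubmodule_eq_monomialSpan_exponentMonoid [Fintype ι] [Nonempty ι] (c : ι → ℕ)
    (hc : ∀ i, 1 ≤ c i) {B : Subalgebra k (TruncPi k c)} (hBA : B ≤ Aplus k c hc)
    (hB : ∀ lam : ι → kˣ, Subalgebra.map (torusHom c fun i => (lam i : k)) B = B) :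
    Subalgebra.toSubmodule B = monomialSpan k c fun i d => d ∈ exponentMonoid B i := by
  rw [toSubmodule_eq_monomialSpan_of_invariant c hc hBA hB]
  ext x
  simp +contextual only [mem_monomialSpan_iff c hc, mem_exponentMonoid_iff]

end TorusInvariance

/-- over an infinite field, a subalgebra of `A⁺` invariant under the full
torus action is spanned by `1` together with the monomials it contains; consequently, the
torus-invariant corank-`g` subalgebras of `A⁺` correspond bijectively (via the monomial
span) to tuples `(M₁, …, M_m)` of numerical monoids with `c(Mᵢ) ≤ cᵢ` and `∑ g(Mᵢ) = g`. -/
theorem torus_invariant_subalgebras_are_monomial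
    {k : Type*} [Field k] [Infinite k] {m : ℕ} (hm : 1 ≤ m)
    (c : Fin m → ℕ) (hc : ∀ i, 1 ≤ c i) :
    (∀ B : Subalgebra k (TruncPi k c), B ≤ Aplus k c hc →
      (∀ lam : Fin m → kˣ, Subalgebra.map (torusHom c fun i => (lam i : k)) B = B) →
      Subalgebra.toSubmodule B = Submodule.span k
        ({1} ∪ {x | ∃ i, ∃ d, 1 ≤ d ∧ d < c i ∧ tpow c i d ∈ B ∧ x = tpow c i d})) ∧
    (∀ g : ℕ,
      (∀ B : Subalgebra k (TruncPi k c), B ≤ Aplus k c hc →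
        (∀ lam : Fin m → kˣ, Subalgebra.map (torusHom c fun i => (lam i : k)) B = B) →
        Module.finrank k ↥B + g = Module.finrank k ↥(Aplus k c hc) →
        ∃! M : Fin m → AddSubmonoid ℕ,
          (∀ i, ∀ n : ℕ, c i ≤ n → n ∈ M i) ∧
          (∑ i, Set.ncard {n : ℕ | n ∉ M i}) = g ∧
          Subalgebra.toSubmodule B = Submodule.span k
            ({1} ∪ {x | ∃ i, ∃ d, 1 ≤ d ∧ d < c i ∧ d ∈ M i ∧ x = tpow c i d})) ∧
      (∀ M : Fin m → AddSubmonoid ℕ,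
        (∀ i, ∀ n : ℕ, c i ≤ n → n ∈ M i) →
        (∑ i, Set.ncard {n : ℕ | n ∉ M i}) = g →
        ∃! B : Subalgebra k (TruncPi k c),
          B ≤ Aplus k c hc ∧
          (∀ lam : Fin m → kˣ, Subalgebra.map (torusHom c fun i => (lam i : k)) B = B) ∧
          Module.finrank k ↥B + g = Module.finrank k ↥(Aplus k c hc) ∧
          Subalgebra.toSubmodule B = Submodule.span k
            ({1} ∪ {x | ∃ i, ∃ d, 1 ≤ d ∧ d < c i ∧ d ∈ M i ∧ x = tpow c i d}))) := by
  have : Nonempty (Fin m) := ⟨⟨0, hm⟩⟩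
  refine ⟨fun B hBA hB => toSubmodule_eq_monomialSpan_of_invariant c hc hBA hB,
    fun g => ⟨fun B hBA hB hg => ?_, fun M hM hg => ?_⟩⟩
  · have hspan := toSubmodule_eq_monomialSpan_exponentMonoid c hc hBA hB
    refine ⟨exponentMonoid B, ⟨fun i n hn => mem_exponentMonoid_of_le B hn, ?_, hspan⟩, ?_⟩
    · exact Nat.add_left_cancel ((finrank_add_sum_ncard_compl c hc
        (fun i n hn => mem_exponentMonoid_of_le B hn) hspan).trans hg.symm)
    · rintro M ⟨hM, -, hMspan⟩
      funext i
      ext d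
      rcases Nat.eq_zero_or_pos d with rfl | h1
      · simp
      by_cases hd : d < c i
      · have hmem := tpow_mem_monomialSpan_iff (k := k) c hc (fun i d => d ∈ M i) h1 hd
        rw [mem_exponentMonoid_iff B h1, ← Subalgebra.mem_toSubmodule, hMspan]
        exact hmem.symm
      · exact iff_of_true (hM i d (not_lt.mp hd)) (mem_exponentMonoid_of_le B (not_lt.mp hd))
  · have hspan : Subalgebra.toSubmodule (monomialSubalgebra k c M) =
        monomialSpan k c fun i d => d ∈ M i := Submodule.toSubalgebra_toSubmodule _ _ _
    refine ⟨monomialSubalgebra k c M, ⟨fun x hx => ?_,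
      map_torusHom_eq_of_toSubmodule_eq c hc _ hspan, ?_, hspan⟩, ?_⟩
    · rw [← Subalgebra.mem_toSubmodule, hspan, mem_monomialSpan_iff c hc] at hx
      exact hx.1
    · rw [← hg]
      exact finrank_add_sum_ncard_compl c hc hM hspan
    · rintro B ⟨-, -, -, hB⟩
      exact Subalgebra.toSubmodule_injective (hB.trans hspan.symm)
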